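/- Let p ≥ 2, α = p−1 and θ ≥ 0, and suppose k₀ > p−1 (i.e. p is not an integer). Then for every σ with 0 < σ < μ_{α,θ} the critical supremum TMC(σ,α,θ) is attained: there exists u ∈ X with ‖u‖ ≤ 1 such that TMC(σ,α,θ) = ∫₀^∞ φ_p(σ|u|^{p/(p−1)}) dλ_θ. -/

import Mathlib

open MeasureTheory Real Filter ENNReal

/-- The fractional-dimension spherical volume constant `ω_θ = 2π^((θ+1)/2)/Γ((θ+1)/2)`. -/
noncomputable def omegaW (θ : ℝ) : ℝ := 2 * Real.pi ^ ((θ + 1) / 2) / Real.Gamma ((θ + 1) / 2)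

/-- Weighted integral `∫₀^∞ f dλ_θ = ω_θ ∫₀^∞ f(r) r^θ dr` (for nonnegative integrands,
valued in `ℝ≥0∞`). -/
noncomputable def wInt (θ : ℝ) (f : ℝ → ℝ) : ℝ≥0∞ :=
  ENNReal.ofReal (omegaW θ) *
    ∫⁻ r in Set.Ioi (0 : ℝ), ENNReal.ofReal (f r) * ENNReal.ofReal (r ^ θ)

/-- The weighted Lebesgue norm `‖u‖_{L^q_θ}` (valued in `ℝ≥0∞`). -/
noncomputable def wNorm (θ q : ℝ) (u : ℝ → ℝ) : ℝ≥0∞ :=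
  (wInt θ fun r => |u r| ^ q) ^ (1 / q)

/-- Membership in the weighted Sobolev space `X = X^{1,p}_∞(α,θ)`:
`u` is locally absolutely continuous on `(0,∞)` with a.e. derivative `u'`
(expressed through the fundamental theorem of calculus on compact subintervals),
`u(r) → 0` as `r → ∞`, `‖u‖_{L^p_θ} < ∞` and `‖u'‖_{L^p_α} < ∞`. -/
structure MemX (p α θ : ℝ) (u u' : ℝ → ℝ) : Prop where
  ftc_int : ∀ a b : ℝ, 0 < a → a ≤ b → IntervalIntegrable u' MeasureTheory.volume a b
  ftc : ∀ a b : ℝ, 0 < a → a ≤ b → u b - u a = ∫ t in a..b, u' t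
  lim_zero : Filter.Tendsto u Filter.atTop (nhds 0)
  fin_u : wNorm θ p u < ⊤
  fin_u' : wNorm α p u' < ⊤

/-- Full norm on `X`: `‖u‖ = (‖u‖_{L^p_θ}^p + ‖u'‖_{L^p_α}^p)^{1/p}`. -/
noncomputable def Xnorm (p α θ : ℝ) (u u' : ℝ → ℝ) : ℝ≥0∞ :=
  ((wNorm θ p u) ^ p + (wNorm α p u') ^ p) ^ (1 / p)

/-- The truncated exponential `φ_p(t) = Σ_{j ∈ ℕ, j ≥ p-1} t^j / j!`. -/
noncomputable def phiP (p t : ℝ) : ℝ :=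
  ∑' j : ℕ, if p - 1 ≤ (j : ℝ) then t ^ j / (Nat.factorial j : ℝ) else 0

/-- The critical constant `μ_{α,θ} = (θ+1) ω_α^{1/α}`. -/
noncomputable def muC (α θ : ℝ) : ℝ := (θ + 1) * (omegaW α) ^ (1 / α)

/-- The Trudinger–Moser functional `∫₀^∞ φ_p(μ |u|^{p/(p-1)}) dλ_θ`. -/
noncomputable def TMfunc (p θ μ : ℝ) (u : ℝ → ℝ) : ℝ≥0∞ :=
  wInt θ fun r => phiP p (μ * |u r| ^ (p / (p - 1)))

/-- The subcritical Trudinger–Moser supremum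
`TMSC(μ,α,θ) = sup { ‖u‖_{L^p_θ}^{-p} ∫₀^∞ φ_p(μ|u|^{p/(p-1)}) dλ_θ : u ∈ X, u ≠ 0, ‖u'‖_{L^p_α} ≤ 1 }`. -/
noncomputable def TMSC (p α θ μ : ℝ) : ℝ≥0∞ :=
  ⨆ (u : ℝ → ℝ) (u' : ℝ → ℝ) (_ : MemX p α θ u u') (_ : u ≠ 0)
    (_ : wNorm α p u' ≤ 1), (wNorm θ p u) ^ (-p) * TMfunc p θ μ u

/-- The critical Trudinger–Moser supremum
`TMC(σ,α,θ) = sup { ∫₀^∞ φ_p(σ|u|^{p/(p-1)}) dλ_θ : u ∈ X, ‖u‖ ≤ 1 }`. -/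
noncomputable def TMC (p α θ σ : ℝ) : ℝ≥0∞ :=
  ⨆ (u : ℝ → ℝ) (u' : ℝ → ℝ) (_ : MemX p α θ u u') (_ : Xnorm p α θ u u' ≤ 1),
    TMfunc p θ σ u

/-- `k₀ = min { j ∈ ℕ : j ≥ p - 1 }`. -/
noncomputable def k0 (p : ℝ) : ℕ := sInf {j : ℕ | p - 1 ≤ (j : ℝ)}

/-- `TMC(σ,α,θ)` is attained by some `u ∈ X` with `‖u‖ ≤ 1`. -/
def TMCAttained (p α θ σ : ℝ) : Prop :=
  ∃ u u' : ℝ → ℝ, MemX p α θ u u' ∧ Xnorm p α θ u u' ≤ 1 ∧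
    TMC p α θ σ = TMfunc p θ σ u

/-- `σ_* = inf { σ ∈ (0, μ_{α,θ}) : TMC(σ,α,θ) is attained }`. -/
noncomputable def sigmaStar (p α θ : ℝ) : ℝ :=
  sInf {σ : ℝ | σ ∈ Set.Ioo 0 (muC α θ) ∧ TMCAttained p α θ σ}

theorem Real.rpow_abs_midpoint_add_le {p : ℝ} (hp : 2 ≤ p) (a b : ℝ) :
    |(a + b) / 2| ^ p + |(a - b) / 2| ^ p ≤ (|a| ^ p + |b| ^ p) / 2 := by
  have key : ∀ x : ℝ, |x| ^ p = (x ^ 2) ^ (p / 2) := fun x => by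
    rw [← sq_abs, ← Real.rpow_natCast_mul (abs_nonneg x)]
    congr 1; push_cast; ring
  simp only [key]
  have h1 := Real.add_rpow_le_rpow_add (sq_nonneg ((a + b) / 2)) (sq_nonneg ((a - b) / 2))
    (show 1 ≤ p / 2 by linarith)
  have h2 := (convexOn_rpow (show 1 ≤ p / 2 by linarith)).2 (Set.mem_Ici.2 (sq_nonneg a))
    (Set.mem_Ici.2 (sq_nonneg b)) (show (0:ℝ) ≤ 1 / 2 by norm_num)
    (show (0:ℝ) ≤ 1 / 2 by norm_num) (by norm_num)
  simp only [smul_eq_mul] at h2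
  have h3 : ((a + b) / 2) ^ 2 + ((a - b) / 2) ^ 2 = 1 / 2 * a ^ 2 + 1 / 2 * b ^ 2 := by ring
  rw [h3] at h1
  linarith

section
variable {Ω : Type*} [MeasurableSpace Ω] {μ : Measure Ω} {p : ℝ}

theorem Lp_norm_rpow_eq_integral (hp : 0 < p) (f : Lp ℝ (ENNReal.ofReal p) μ) :
    ‖f‖ ^ p = ∫ x, |f x| ^ p ∂μ := by
  have h0 : ENNReal.ofReal p ≠ 0 := by simpa using hp
  have h := (Lp.memLp f).eLpNorm_eq_integral_rpow_norm h0 ENNReal.ofReal_ne_top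
  rw [ENNReal.toReal_ofReal hp.le] at h
  have hnn : 0 ≤ ∫ x, ‖f x‖ ^ p ∂μ := integral_nonneg fun x => by positivity
  rw [Lp.norm_def, h, ENNReal.toReal_ofReal (by positivity), ← Real.rpow_mul hnn,
    inv_mul_cancel₀ hp.ne', Real.rpow_one]
  rfl

theorem Lp_integrable_abs_rpow (hp : 0 < p) (f : Lp ℝ (ENNReal.ofReal p) μ) :
    Integrable (fun x => |f x| ^ p) μ := by
  have h0 : ENNReal.ofReal p ≠ 0 := by simpa using hp
  have h := (Lp.memLp f).integrable_norm_rpow h0 ENNReal.ofReal_ne_top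
  rwa [ENNReal.toReal_ofReal hp.le] at h

/-- Clarkson's first inequality. -/
theorem Lp_clarkson (hp : 2 ≤ p) (f g : Lp ℝ (ENNReal.ofReal p) μ) :
    ‖(1 / 2 : ℝ) • (f + g)‖ ^ p + ‖(1 / 2 : ℝ) • (f - g)‖ ^ p ≤ (‖f‖ ^ p + ‖g‖ ^ p) / 2 := by
  have hp0 : 0 < p := by linarith
  simp only [Lp_norm_rpow_eq_integral hp0]
  have i1 := Lp_integrable_abs_rpow (μ := μ) hp0
  rw [← integral_add (i1 _) (i1 _), ← integral_add (i1 _) (i1 _), ← integral_div]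
  refine integral_mono_ae ((i1 _).add (i1 _)) (((i1 _).add (i1 _)).div_const _) ?_
  filter_upwards [Lp.coeFn_smul (1 / 2 : ℝ) (f + g), Lp.coeFn_smul (1 / 2 : ℝ) (f - g),
    Lp.coeFn_add f g, Lp.coeFn_sub f g] with x h1 h2 h3 h4
  simp only [h1, h2, Pi.smul_apply, h3, h4, Pi.add_apply, Pi.sub_apply, smul_eq_mul]
  rw [one_div_mul_eq_div, one_div_mul_eq_div]
  exact Real.rpow_abs_midpoint_add_le hp (f x) (g x)

/-- A bounded sequence in `L^p`, `p ≥ 2`, on which a weak limit can be tested has a weak limit. -/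
theorem Lp_exists_weak_limit (hp : 2 ≤ p) [Fact (1 ≤ ENNReal.ofReal p)]
    (g : ℕ → Lp ℝ (ENNReal.ofReal p) μ) {b : ℝ} (hb : Tendsto (fun n => ‖g n‖) atTop (nhds b)) :
    ∃ G : Lp ℝ (ENNReal.ofReal p) μ, ‖G‖ ≤ b ∧
      ∀ (ℓ : Lp ℝ (ENNReal.ofReal p) μ →L[ℝ] ℝ) (c : ℝ),
        Tendsto (fun n => ℓ (g n)) atTop (nhds c) → ℓ G = c := by
  have hp0 : 0 < p := by linarith
  set K : ℕ → Set (Lp ℝ (ENNReal.ofReal p) μ) := fun n => convexHull ℝ (g '' Set.Ici n) with hK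
  have hKa : ∀ {m n}, m ≤ n → K n ⊆ K m := fun h =>
    convexHull_mono (Set.image_mono (Set.Ici_subset_Ici.2 h))
  have hKg : ∀ n, g n ∈ K n := fun n => subset_convexHull _ _ ⟨n, Set.mem_Ici.2 le_rfl, rfl⟩
  set S : ℕ → Set ℝ := fun n => (fun f => ‖f‖ ^ p) '' K n with hS
  have hSb : ∀ n, BddBelow (S n) := fun n => ⟨0, by rintro _ ⟨f, -, rfl⟩; positivity⟩
  have hSne : ∀ n, (S n).Nonempty := fun n => ⟨_, g n, hKg n, rfl⟩
  set d : ℕ → ℝ := fun n => sInf (S n) with hd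
  have hdm : Monotone d := fun m n h => csInf_le_csInf (hSb m) (hSne n) (Set.image_mono (hKa h))
  obtain ⟨M, hM⟩ := hb.bddAbove_range
  have hdb : BddAbove (Set.range d) := by
    refine ⟨M ^ p, ?_⟩
    rintro _ ⟨n, rfl⟩
    refine (csInf_le (hSb n) ⟨g n, hKg n, rfl⟩).trans ?_
    exact Real.rpow_le_rpow (norm_nonneg _) (hM ⟨n, rfl⟩) hp0.le
  set L := ⨆ n, d n with hL
  have hdL : Tendsto d atTop (nhds L) := tendsto_atTop_ciSup hdm hdb
  have hw : ∀ n : ℕ, ∃ f ∈ K n, ‖f‖ ^ p < d n + 1 / ((n : ℝ) + 1) := fun n => by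
    obtain ⟨_, ⟨f, hf, rfl⟩, h⟩ := exists_lt_of_csInf_lt (hSne n)
      (show d n < d n + 1 / ((n : ℝ) + 1) by have : 0 < 1 / ((n : ℝ) + 1) := by positivity
                                             linarith)
    exact ⟨f, hf, h⟩
  choose w hwK hwd using hw
  have hest : ∀ N m n, N ≤ m → N ≤ n →
      ‖(1 / 2 : ℝ) • (w m - w n)‖ ^ p ≤ L - d N + 1 / ((N : ℝ) + 1) := by
    intro N m n hm hn
    have h1 := Lp_clarkson hp (w m) (w n)
    have hmem : (1 / 2 : ℝ) • (w m + w n) ∈ K N := by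
      rw [smul_add]
      exact (convex_convexHull ℝ _) (hKa hm (hwK m)) (hKa hn (hwK n)) (by norm_num) (by norm_num)
        (by norm_num)
    have h2 : d N ≤ ‖(1 / 2 : ℝ) • (w m + w n)‖ ^ p := csInf_le (hSb N) ⟨_, hmem, rfl⟩
    have h3 : ∀ k, N ≤ k → ‖w k‖ ^ p ≤ L + 1 / ((N : ℝ) + 1) := fun k hk => by
      have : 1 / ((k : ℝ) + 1) ≤ 1 / ((N : ℝ) + 1) := by gcongr
      linarith [hwd k, le_ciSup hdb k]
    linarith [h3 m hm, h3 n hn]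
  have hlim : Tendsto (fun N : ℕ => 2 * (L - d N + 1 / ((N : ℝ) + 1)) ^ (1 / p)) atTop (nhds 0) := by
    have h1 : Tendsto (fun N : ℕ => L - d N + 1 / ((N : ℝ) + 1)) atTop (nhds 0) := by
      simpa using (hdL.const_sub L).add tendsto_one_div_add_atTop_nhds_zero_nat
    have h2 := (h1.rpow_const (Or.inr (by positivity : 0 ≤ 1 / p))).const_mul 2
    rwa [Real.zero_rpow (by positivity), mul_zero] at h2
  have hcau : CauchySeq w := by
    refine cauchySeq_of_le_tendsto_0 _ (fun m n N hm hn => ?_) hlim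
    have h := hest N m n hm hn
    have h2 := Real.rpow_le_rpow (by positivity) h (by positivity : 0 ≤ 1 / p)
    rw [← Real.rpow_mul (norm_nonneg _), mul_one_div_cancel hp0.ne', Real.rpow_one, norm_smul] at h2
    rw [dist_eq_norm]
    norm_num at h2 ⊢
    linarith
  obtain ⟨G, hG⟩ := cauchySeq_tendsto_of_complete hcau
  refine ⟨G, le_of_forall_pos_le_add fun ε hε => ?_, fun ℓ c hc => ?_⟩
  · obtain ⟨N, hN⟩ := eventually_atTop.1 (hb.eventually_le_const (show b < b + ε by linarith))
    refine le_of_tendsto hG.norm (eventually_atTop.2 ⟨N, fun n hn => ?_⟩)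
    have : K N ⊆ Metric.closedBall 0 (b + ε) := by
      refine convexHull_min ?_ (convex_closedBall _ _)
      rintro _ ⟨k, hk, rfl⟩
      simpa using hN k hk
    simpa using this (hKa hn (hwK n))
  · refine tendsto_nhds_unique (ℓ.continuous.continuousAt.tendsto.comp hG) ?_
    rw [Metric.tendsto_atTop'] at hc
    refine Metric.tendsto_atTop.2 fun ε hε => ?_
    obtain ⟨N, hN⟩ := hc ε hε
    refine ⟨N + 1, fun n hn => ?_⟩
    have : K (N + 1) ⊆ ℓ ⁻¹' Metric.ball c ε := by
      refine convexHull_min ?_ ((convex_ball _ _).linear_preimage ℓ.toLinearMap)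
      rintro _ ⟨k, hk, rfl⟩
      exact hN k hk
    exact this (hKa hn (hwK n))
end
theorem le_natCast_iff_k0_le {p : ℝ} (j : ℕ) : p - 1 ≤ (j : ℝ) ↔ k0 p ≤ j := by
  have hne : {j : ℕ | p - 1 ≤ (j : ℝ)}.Nonempty := exists_nat_ge (p - 1)
  refine ⟨fun h => Nat.sInf_le h, fun h => ?_⟩
  have h1 : p - 1 ≤ (k0 p : ℝ) := Nat.sInf_mem hne
  exact h1.trans (by exact_mod_cast h)

theorem phiP_eq_tsum (p t : ℝ) :
    phiP p t = ∑' i : ℕ, t ^ (i + k0 p) / ((i + k0 p).factorial : ℝ) := by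
  have hs : Summable fun j : ℕ => if p - 1 ≤ (j : ℝ) then t ^ j / (j.factorial : ℝ) else 0 :=
    ((Real.summable_pow_div_factorial t).abs).of_norm_bounded fun j => by
      split_ifs
      · simp [abs_div]
      · simp only [norm_zero]; positivity
  rw [phiP, ← hs.sum_add_tsum_nat_add (k0 p), Finset.sum_eq_zero, zero_add]
  · refine tsum_congr fun i => if_pos ?_
    rw [le_natCast_iff_k0_le]; omega
  · intro i hi
    rw [if_neg]
    rw [le_natCast_iff_k0_le]; simpa using hi

theorem phiP_eq_exp_sub (p t : ℝ) :
    phiP p t = Real.exp t - ∑ j ∈ Finset.range (k0 p), t ^ j / (j.factorial : ℝ) := by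
  simp only [phiP_eq_tsum, Real.exp_eq_exp_ℝ, NormedSpace.exp_eq_tsum_div]
  rw [← (Real.summable_pow_div_factorial t).sum_add_tsum_nat_add (k0 p)]
  ring

theorem continuous_phiP (p : ℝ) : Continuous (phiP p) := by
  rw [show phiP p = fun t => Real.exp t - ∑ j ∈ Finset.range (k0 p), t ^ j / (j.factorial : ℝ) from
    funext (phiP_eq_exp_sub p)]
  fun_prop

theorem phiP_nonneg (p : ℝ) {t : ℝ} (ht : 0 ≤ t) : 0 ≤ phiP p t := by
  rw [phiP_eq_tsum]
  exact tsum_nonneg fun i => by positivity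

theorem phiP_le_exp (p : ℝ) {t : ℝ} (ht : 0 ≤ t) : phiP p t ≤ Real.exp t := by
  rw [phiP_eq_exp_sub]
  have : 0 ≤ ∑ j ∈ Finset.range (k0 p), t ^ j / (j.factorial : ℝ) :=
    Finset.sum_nonneg fun i _ => by positivity
  linarith

theorem phiP_le_pow_mul_exp (p : ℝ) {t : ℝ} (ht : 0 ≤ t) :
    phiP p t ≤ t ^ k0 p * Real.exp t := by
  have hs := Real.summable_pow_div_factorial t
  simp only [phiP_eq_tsum, Real.exp_eq_exp_ℝ, NormedSpace.exp_eq_tsum_div, ← tsum_mul_left]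
  refine Summable.tsum_le_tsum (fun i => ?_) ((summable_nat_add_iff (k0 p)).2 hs) (hs.mul_left _)
  rw [pow_add, mul_comm (t ^ i), mul_div_assoc]
  have : i.factorial ≤ (i + k0 p).factorial := Nat.factorial_le (by omega)
  gcongr

theorem omegaW_pos {θ : ℝ} (hθ : 0 ≤ θ) : 0 < omegaW θ := by
  have := Real.Gamma_pos_of_pos (show 0 < (θ + 1) / 2 by linarith)
  unfold omegaW
  positivity

/-- Hölder continuity, of exponent `1 / q`, in the logarithmic variable. -/
def LogHolder (D q : ℝ) (u : ℝ → ℝ) : Prop :=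
  ∀ r s : ℝ, 0 < r → 0 < s → |u s - u r| ≤ D * |Real.log s - Real.log r| ^ (1 / q)

theorem tendsto_mul_abs_log_sub_rpow (D : ℝ) {q r : ℝ} (hq : 0 < q) (hr : 0 < r) :
    Tendsto (fun s => D * |Real.log s - Real.log r| ^ (1 / q)) (nhds r) (nhds 0) := by
  have h1 : Tendsto (fun s => |Real.log s - Real.log r|) (nhds r) (nhds 0) := by
    simpa using ((Real.continuousAt_log hr.ne').tendsto.sub_const (Real.log r)).abs
  have h2 := (h1.rpow_const (Or.inr (by positivity : 0 ≤ 1 / q))).const_mul D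
  rwa [Real.zero_rpow (by positivity), mul_zero] at h2

theorem LogHolder.continuousOn {D q : ℝ} {u : ℝ → ℝ} (hq : 0 < q) (hu : LogHolder D q u) :
    ContinuousOn u (Set.Ioi 0) := by
  intro r hr
  refine ContinuousAt.continuousWithinAt ?_
  rw [ContinuousAt, tendsto_iff_dist_tendsto_zero]
  refine squeeze_zero' (Eventually.of_forall fun _ => dist_nonneg) ?_
    (tendsto_mul_abs_log_sub_rpow D hq hr)
  filter_upwards [lt_mem_nhds (Set.mem_Ioi.1 hr)] with s hs
  exact hu r s hr hs

theorem LogHolder.exists_uniform_decay {p θ D q : ℝ} (hp : 0 < p) (hθ : 0 ≤ θ) (hq : 0 < q)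
    (hD : 0 < D) {ε : ℝ} (hε : 0 < ε) :
    ∃ R : ℝ, 1 ≤ R ∧ ∀ u : ℝ → ℝ, LogHolder D q u → wInt θ (fun r => |u r| ^ p) ≤ 1 →
      ∀ r, R ≤ r → |u r| ≤ ε := by
  have hω := omegaW_pos hθ
  set L : ℝ := (ε / (2 * D)) ^ q with hL
  have hL0 : 0 < L := by positivity
  have hDL : D * L ^ (1 / q) = ε / 2 := by
    rw [hL, ← Real.rpow_mul (by positivity), mul_one_div_cancel hq.ne', Real.rpow_one]
    field_simp
  have hexp : 0 < Real.exp L - 1 := by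
    have := Real.add_one_lt_exp hL0.ne'
    linarith
  set c : ℝ := omegaW θ * ((ε / 2) ^ p * (Real.exp L - 1)) with hc
  have hc0 : 0 < c := by positivity
  refine ⟨max 1 (2 / c), le_max_left _ _, fun u hu hA r hr => ?_⟩
  by_contra! hcon
  have hr1 : 1 ≤ r := (le_max_left _ _).trans hr
  have hr0 : 0 < r := by linarith
  have hcr : 2 ≤ c * r := by
    have := (le_max_right _ _).trans hr
    rwa [div_le_iff₀' hc0] at this
  have hlow : ∀ s ∈ Set.Icc r (Real.exp L * r), ε / 2 ≤ |u s| := by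
    intro s hs
    have hs0 : 0 < s := hr0.trans_le hs.1
    have h1 : 0 ≤ Real.log s - Real.log r := sub_nonneg.2 (Real.log_le_log hr0 hs.1)
    have h2 : Real.log s - Real.log r ≤ L := by
      have := Real.log_le_log hs0 hs.2
      rw [Real.log_mul (Real.exp_pos _).ne' hr0.ne', Real.log_exp] at this
      linarith
    have h3 := hu r s hr0 hs0
    rw [abs_of_nonneg h1] at h3
    have h4 : D * (Real.log s - Real.log r) ^ (1 / q) ≤ D * L ^ (1 / q) := by gcongr
    have h5 : |u r| - |u s| ≤ |u s - u r| := by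
      rw [abs_sub_comm]; exact abs_sub_abs_le_abs_sub _ _
    linarith
  have hlt : ENNReal.ofReal (c * r) ≤ wInt θ (fun r => |u r| ^ p) := by
    have hsub : Set.Icc r (Real.exp L * r) ⊆ Set.Ioi 0 := fun s hs => hr0.trans_le hs.1
    calc ENNReal.ofReal (c * r)
        = ENNReal.ofReal (omegaW θ) *
          (ENNReal.ofReal ((ε / 2) ^ p) * ENNReal.ofReal (Real.exp L * r - r)) := by
          rw [← ENNReal.ofReal_mul (by positivity), ← ENNReal.ofReal_mul (by positivity)]
          congr 1; rw [hc]; ring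
      _ = ENNReal.ofReal (omegaW θ) * ∫⁻ _ in Set.Icc r (Real.exp L * r),
            ENNReal.ofReal ((ε / 2) ^ p) := by
          rw [setLIntegral_const, Real.volume_Icc]
      _ ≤ ENNReal.ofReal (omegaW θ) * ∫⁻ s in Set.Icc r (Real.exp L * r),
            ENNReal.ofReal (|u s| ^ p) * ENNReal.ofReal (s ^ θ) := by
          gcongr 1
          refine setLIntegral_mono' measurableSet_Icc fun s hs => ?_
          rw [← ENNReal.ofReal_mul (by positivity)]
          refine ENNReal.ofReal_le_ofReal ?_
          have h1 : (ε / 2) ^ p ≤ |u s| ^ p :=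
            Real.rpow_le_rpow (by positivity) (hlow s hs) hp.le
          have h2 : 1 ≤ s ^ θ := Real.one_le_rpow (hr1.trans hs.1) hθ
          have h3 : 0 ≤ |u s| ^ p := by positivity
          nlinarith
      _ ≤ _ := by
          unfold wInt
          gcongr
  have h2 : ENNReal.ofReal 2 ≤ 1 := (ENNReal.ofReal_le_ofReal hcr).trans (hlt.trans hA)
  norm_num at h2

theorem Real.one_add_rpow_le {q η x : ℝ} (hq : 0 < q) (hη : 0 < η) (hx : 0 ≤ x) :
    (1 + x) ^ q ≤ (1 + 1 / η) ^ q + (1 + η) ^ q * x ^ q := by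
  have h0 : 0 ≤ (1 + 1 / η) ^ q := by positivity
  have h1 : 0 ≤ (1 + η) ^ q * x ^ q := by positivity
  rcases le_total x (1 / η) with h | h
  · have : (1 + x) ^ q ≤ (1 + 1 / η) ^ q := by gcongr
    linarith
  · have h2 : 1 + x ≤ (1 + η) * x := by
      rw [div_le_iff₀' hη] at h
      linarith
    have : (1 + x) ^ q ≤ ((1 + η) * x) ^ q := by gcongr
    rw [Real.mul_rpow (by positivity) hx] at this
    linarith

/-- Near the origin a log-Hölder function has a subcritical exponential bound. -/
theorem exists_subcritical_exp_bound {θ D q σ : ℝ} (hq : 0 < q) (hD : 0 < D)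
    (hσ : 0 < σ) (hcrit : σ * D ^ q < θ + 1) :
    ∃ κ K : ℝ, κ < θ + 1 ∧ ∀ (R : ℝ) (u : ℝ → ℝ), 0 < R → LogHolder D q u → |u R| ≤ 1 →
      ∀ r ∈ Set.Ioc 0 R, Real.exp (σ * |u r| ^ q) ≤ Real.exp K * (R ^ κ * r ^ (-κ)) := by
  obtain ⟨η, hη, hηlt⟩ : ∃ η : ℝ, 0 < η ∧ σ * (1 + η) ^ q * D ^ q < θ + 1 := by
    have ht : Tendsto (fun η : ℝ => σ * (1 + η) ^ q * D ^ q) (nhdsWithin 0 (Set.Ioi 0))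
        (nhds (σ * (1 + 0) ^ q * D ^ q)) := by
      refine Tendsto.mono_left ?_ nhdsWithin_le_nhds
      have : ContinuousAt (fun η : ℝ => σ * (1 + η) ^ q * D ^ q) 0 := by
        have h : ContinuousAt (fun η : ℝ => (1 + η) ^ q) 0 :=
          ContinuousAt.rpow_const (by fun_prop) (Or.inr hq.le)
        fun_prop
      exact this.tendsto
    have hev := ht.eventually_lt_const (show σ * (1 + 0) ^ q * D ^ q < θ + 1 by simpa using hcrit)
    obtain ⟨η, h1, h2⟩ := (hev.and self_mem_nhdsWithin).exists
    exact ⟨η, h2, h1⟩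
  refine ⟨σ * (1 + η) ^ q * D ^ q, σ * (1 + 1 / η) ^ q, hηlt, fun R u hR hu hu1 r hr => ?_⟩
  set κ := σ * (1 + η) ^ q * D ^ q with hκ
  have hr0 : 0 < r := hr.1
  have hlog : 0 ≤ Real.log R - Real.log r := sub_nonneg.2 (Real.log_le_log hr0 hr.2)
  have h1 : |u r| ≤ 1 + D * (Real.log R - Real.log r) ^ (1 / q) := by
    have h := hu r R hr0 hR
    rw [abs_of_nonneg hlog] at h
    have h5 : |u r| - |u R| ≤ |u R - u r| := by
      rw [abs_sub_comm]; exact abs_sub_abs_le_abs_sub _ _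
    linarith
  have h2 : |u r| ^ q ≤ (1 + 1 / η) ^ q + (1 + η) ^ q * (D ^ q * (Real.log R - Real.log r)) := by
    calc |u r| ^ q ≤ (1 + D * (Real.log R - Real.log r) ^ (1 / q)) ^ q := by gcongr
      _ ≤ _ := Real.one_add_rpow_le hq hη (by positivity)
      _ = _ := by
        rw [Real.mul_rpow hD.le (by positivity), ← Real.rpow_mul hlog, one_div_mul_cancel hq.ne',
          Real.rpow_one]
  have h3 : R ^ κ * r ^ (-κ) = Real.exp (κ * (Real.log R - Real.log r)) := by
    rw [Real.rpow_def_of_pos hR, Real.rpow_def_of_pos hr0, ← Real.exp_add]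
    congr 1; ring
  rw [h3, ← Real.exp_add]
  refine Real.exp_le_exp.2 ?_
  calc σ * |u r| ^ q ≤ σ * ((1 + 1 / η) ^ q + (1 + η) ^ q * (D ^ q * (Real.log R - Real.log r))) := by
        gcongr
    _ = _ := by rw [hκ]; ring

theorem phiP_le_mul_rpow {p q σ ε t : ℝ} (hq : 0 ≤ q) (hp : 0 < p) (hpq : p ≤ q * k0 p)
    (hσ : 0 < σ) (hε : ε ≤ 1) (ht0 : 0 ≤ t) (ht : t ≤ ε) :
    phiP p (σ * t ^ q) ≤ σ ^ k0 p * Real.exp σ * ε ^ (q * k0 p - p) * t ^ p := by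
  have ht1 : t ^ q ≤ 1 := Real.rpow_le_one ht0 (ht.trans hε) hq
  have h1 : (t ^ q) ^ k0 p ≤ ε ^ (q * k0 p - p) * t ^ p := by
    rw [← Real.rpow_mul_natCast ht0, show q * (k0 p : ℝ) = (q * k0 p - p) + p by ring,
      Real.rpow_add_of_nonneg ht0 (by linarith) hp.le, add_sub_cancel_right]
    gcongr
  have h2 : Real.exp (σ * t ^ q) ≤ Real.exp σ := Real.exp_le_exp.2 (by nlinarith)
  calc phiP p (σ * t ^ q) ≤ (σ * t ^ q) ^ k0 p * Real.exp (σ * t ^ q) :=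
        phiP_le_pow_mul_exp p (by positivity)
    _ = σ ^ k0 p * (t ^ q) ^ k0 p * Real.exp (σ * t ^ q) := by rw [mul_pow]
    _ ≤ σ ^ k0 p * (ε ^ (q * k0 p - p) * t ^ p) * Real.exp σ := by
        have : 0 ≤ ε := ht0.trans ht
        gcongr
    _ = _ := by ring

theorem aemeasurable_TM_integrand {p q θ D σ : ℝ} {u : ℝ → ℝ} {s : Set ℝ} (hq : 0 < q)
    (hu : LogHolder D q u) (hs : MeasurableSet s) (hs0 : s ⊆ Set.Ioi 0) :
    AEMeasurable (fun r => ENNReal.ofReal (phiP p (σ * |u r| ^ q)) * ENNReal.ofReal (r ^ θ))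
      (volume.restrict s) := by
  have hm : AEMeasurable u (volume.restrict s) :=
    ((hu.continuousOn hq).mono hs0).aemeasurable hs
  have h1 : AEMeasurable (fun r => phiP p (σ * |u r| ^ q)) (volume.restrict s) :=
    (continuous_phiP p).measurable.comp_aemeasurable
      (((measurable_norm.comp_aemeasurable hm).pow_const q).const_mul σ)
  exact h1.ennreal_ofReal.mul (by fun_prop)

/-- Subcritical upper semicontinuity of the Trudinger–Moser functional along pointwise
convergence, for non-integer `p`. -/
theorem le_TMfunc_of_tendsto {p θ q D σ : ℝ} (hp : 0 < p) (hθ : 0 ≤ θ) (hq : q = p / (p - 1))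
    (hq0 : 0 < q) (hpq : p < q * k0 p) (hD : 0 < D) (hσ : 0 < σ) (hcrit : σ * D ^ q < θ + 1)
    {u : ℕ → ℝ → ℝ} {v : ℝ → ℝ} (hu : ∀ n, LogHolder D q (u n))
    (hA : ∀ n, wInt θ (fun r => |u n r| ^ p) ≤ 1)
    (hlim : ∀ r, 0 < r → Tendsto (fun n => u n r) atTop (nhds (v r))) {T : ℝ≥0∞}
    (hT : Tendsto (fun n => TMfunc p θ σ (u n)) atTop (nhds T)) : T ≤ TMfunc p θ σ v := by
  set γ := q * k0 p - p with hγ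
  have hγ0 : 0 < γ := by linarith
  set C := σ ^ k0 p * Real.exp σ with hC
  have hC0 : 0 < C := by positivity
  obtain ⟨κ, K, hκ, hexp⟩ := exists_subcritical_exp_bound hq0 hD hσ hcrit
  refine ENNReal.le_of_forall_pos_le_add fun δ hδ _ => ?_
  have hδ' : (0 : ℝ) < δ := hδ
  obtain ⟨ε, hε0, hε1, hεδ⟩ : ∃ ε : ℝ, 0 < ε ∧ ε ≤ 1 ∧ C * ε ^ γ ≤ δ := by
    refine ⟨min 1 ((δ / C) ^ (1 / γ)), by positivity, min_le_left _ _, ?_⟩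
    calc C * (min 1 ((δ / C) ^ (1 / γ))) ^ γ ≤ C * ((δ / C) ^ (1 / γ)) ^ γ := by
          gcongr
          exact min_le_right _ _
      _ = δ := by
          rw [← Real.rpow_mul (by positivity), one_div_mul_cancel hγ0.ne', Real.rpow_one]
          field_simp
  obtain ⟨R, hR1, hR⟩ := LogHolder.exists_uniform_decay hp hθ hq0 hD hε0
  have hR0 : 0 < R := by linarith
  have hω : ENNReal.ofReal (omegaW θ) ≠ ⊤ := ENNReal.ofReal_ne_top
  set Φ : (ℝ → ℝ) → ℝ → ℝ≥0∞ := fun w r =>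
    ENNReal.ofReal (phiP p (σ * |w r| ^ q)) * ENNReal.ofReal (r ^ θ) with hΦ
  have hTM : ∀ w, TMfunc p θ σ w = ENNReal.ofReal (omegaW θ) * ∫⁻ r in Set.Ioi 0, Φ w r := by
    intro w
    simp only [TMfunc, wInt, hΦ, hq]
  have htail : ∀ n, ENNReal.ofReal (omegaW θ) * ∫⁻ r in Set.Ioi R, Φ (u n) r ≤ δ := by
    intro n
    calc ENNReal.ofReal (omegaW θ) * ∫⁻ r in Set.Ioi R, Φ (u n) r
        ≤ ENNReal.ofReal (omegaW θ) * ∫⁻ r in Set.Ioi R,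
          ENNReal.ofReal (C * ε ^ γ) * (ENNReal.ofReal (|u n r| ^ p) * ENNReal.ofReal (r ^ θ)) := by
          gcongr 1
          refine setLIntegral_mono' measurableSet_Ioi fun r hr => ?_
          change ENNReal.ofReal (phiP p (σ * |u n r| ^ q)) * ENNReal.ofReal (r ^ θ) ≤ _
          rw [← mul_assoc, ← ENNReal.ofReal_mul (p := C * ε ^ γ) (by positivity)]
          gcongr
          exact phiP_le_mul_rpow hq0.le hp hpq.le hσ hε1 (abs_nonneg _)
            (hR (u n) (hu n) (hA n) r (le_of_lt hr))
      _ = ENNReal.ofReal (C * ε ^ γ) * (ENNReal.ofReal (omegaW θ) * ∫⁻ r in Set.Ioi R,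
            ENNReal.ofReal (|u n r| ^ p) * ENNReal.ofReal (r ^ θ)) := by
          rw [lintegral_const_mul' _ _ ENNReal.ofReal_ne_top, mul_left_comm]
      _ ≤ ENNReal.ofReal (C * ε ^ γ) * 1 := by
          gcongr
          refine le_trans ?_ (hA n)
          unfold wInt
          gcongr
      _ ≤ δ := by
          rw [mul_one]
          exact ENNReal.ofReal_le_of_le_toReal (by simpa using hεδ)
  have hmain : Tendsto (fun n => ENNReal.ofReal (omegaW θ) * ∫⁻ r in Set.Ioc 0 R, Φ (u n) r) atTop
      (nhds (ENNReal.ofReal (omegaW θ) * ∫⁻ r in Set.Ioc 0 R, Φ v r)) := by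
    refine ENNReal.Tendsto.const_mul ?_ (Or.inr hω)
    refine tendsto_lintegral_of_dominated_convergence'
      (fun r => ENNReal.ofReal (Real.exp K * R ^ κ * r ^ (θ - κ))) (fun n =>
        aemeasurable_TM_integrand hq0 (hu n) measurableSet_Ioc Set.Ioc_subset_Ioi_self)
      (fun n => ?_) ?_ ?_
    · filter_upwards [ae_restrict_mem measurableSet_Ioc] with r hr
      have hr0 : 0 < r := hr.1
      have huR : |u n R| ≤ 1 := (hR (u n) (hu n) (hA n) R le_rfl).trans hε1
      have h := (phiP_le_exp p (by positivity : 0 ≤ σ * |u n r| ^ q)).trans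
        (hexp R (u n) hR0 (hu n) huR r hr)
      rw [hΦ]
      simp only
      rw [← ENNReal.ofReal_mul (phiP_nonneg p (by positivity))]
      refine ENNReal.ofReal_le_ofReal ?_
      calc phiP p (σ * |u n r| ^ q) * r ^ θ ≤ Real.exp K * (R ^ κ * r ^ (-κ)) * r ^ θ := by gcongr
        _ = Real.exp K * R ^ κ * (r ^ (-κ) * r ^ θ) := by ring
        _ = _ := by rw [← Real.rpow_add hr0]; congr 2; ring
    · have hi : IntervalIntegrable (fun r : ℝ => r ^ (θ - κ)) volume 0 R :=
        intervalIntegral.intervalIntegrable_rpow' (by linarith)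
      rw [intervalIntegrable_iff_integrableOn_Ioc_of_le hR0.le] at hi
      exact ((hi.const_mul (Real.exp K * R ^ κ)).lintegral_lt_top).ne
    · filter_upwards [ae_restrict_mem measurableSet_Ioc] with r hr
      refine ENNReal.Tendsto.mul_const ?_ (Or.inr ENNReal.ofReal_ne_top)
      refine ENNReal.tendsto_ofReal ?_
      refine (continuous_phiP p).continuousAt.tendsto.comp ?_
      exact ((hlim r hr.1).abs.rpow_const (Or.inr hq0.le)).const_mul σ
  refine le_trans (le_of_tendsto_of_tendsto' hT (hmain.add_const (δ : ℝ≥0∞)) fun n => ?_) ?_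
  · rw [hTM, ← Set.Ioc_union_Ioi_eq_Ioi hR0.le]
    refine le_trans (mul_le_mul_right (lintegral_union_le _ _ _) _) ?_
    rw [mul_add]
    gcongr
    exact htail n
  · rw [hTM]
    gcongr
    exact Set.Ioc_subset_Ioi_self

section
variable {p q : ℝ}

theorem exists_weighted_interval_functional (hpq : p.HolderConjugate q)
    [Fact (1 ≤ ENNReal.ofReal p)] {a b : ℝ} (ha : 0 < a) (hab : a ≤ b) :
    ∃ ℓ : Lp ℝ (ENNReal.ofReal p) (volume.restrict (Set.Ioi (0 : ℝ))) →L[ℝ] ℝ, ∀ f,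
      IntervalIntegrable (fun t => f t * t ^ (-(1 / q))) volume a b ∧
      ℓ f = ∫ t in a..b, f t * t ^ (-(1 / q)) ∧
      |ℓ f| ≤ ‖f‖ * (Real.log b - Real.log a) ^ (1 / q) := by
  set μ : Measure ℝ := volume.restrict (Set.Ioi (0 : ℝ)) with hμ
  have hp0 : 0 < p := hpq.pos
  have hq0 : 0 < q := hpq.symm.pos
  have hsub : Set.Ioc a b ⊆ Set.Ioi 0 := fun t ht => ha.trans ht.1
  set k : ℝ → ℝ := (Set.Ioc a b).indicator fun t => t ^ (-(1 / q)) with hk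
  have hkq : ∀ t, ‖k t‖ ^ q = (Set.Ioc a b).indicator (fun t => t⁻¹) t := by
    intro t
    by_cases ht : t ∈ Set.Ioc a b
    · have ht0 : 0 < t := hsub ht
      rw [hk, Set.indicator_of_mem ht, Set.indicator_of_mem ht,
        Real.norm_of_nonneg (by positivity), ← Real.rpow_mul ht0.le, neg_mul,
        one_div_mul_cancel hq0.ne', Real.rpow_neg_one]
    · rw [hk, Set.indicator_of_notMem ht, Set.indicator_of_notMem ht, norm_zero,
        Real.zero_rpow hq0.ne']
  have hinv : IntegrableOn (fun t : ℝ => t⁻¹) (Set.Ioc a b) := by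
    refine (ContinuousOn.integrableOn_Icc ?_).mono_set Set.Ioc_subset_Icc_self
    exact continuousOn_inv₀.mono fun t ht => (ha.trans_le ht.1).ne'
  have hkm : AEStronglyMeasurable k μ := by
    refine (Measurable.indicator ?_ measurableSet_Ioc).aestronglyMeasurable
    fun_prop
  have hrestr : μ.restrict (Set.Ioc a b) = volume.restrict (Set.Ioc a b) := by
    rw [hμ, Measure.restrict_restrict measurableSet_Ioc, Set.inter_eq_left.2 hsub]
  have hkL : MemLp k (ENNReal.ofReal q) μ := by
    rw [← integrable_norm_rpow_iff hkm (by simpa using hq0) ENNReal.ofReal_ne_top,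
      ENNReal.toReal_ofReal hq0.le]
    simp only [hkq]
    rw [integrable_indicator_iff measurableSet_Ioc, IntegrableOn, hrestr]
    exact hinv
  have hkint : ∫ t, ‖k t‖ ^ q ∂μ = Real.log b - Real.log a := by
    simp only [hkq]
    rw [integral_indicator measurableSet_Ioc, hrestr, ← intervalIntegral.integral_of_le hab,
      integral_inv_of_pos ha (ha.trans_le hab), Real.log_div (ha.trans_le hab).ne' ha.ne']
  have hfk : ∀ f : ℝ → ℝ, (fun t => k t * f t) =
      (Set.Ioc a b).indicator fun t => f t * t ^ (-(1 / q)) := by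
    intro f
    ext t
    by_cases ht : t ∈ Set.Ioc a b
    · simp [hk, Set.indicator_of_mem ht, mul_comm]
    · simp [hk, Set.indicator_of_notMem ht]
  have hconj : ENNReal.HolderConjugate (ENNReal.ofReal q) (ENNReal.ofReal p) :=
    hpq.symm.ennrealOfReal
  have hq1 : Fact (1 ≤ ENNReal.ofReal q) := ⟨by
    rw [ENNReal.one_le_ofReal]; exact hpq.symm.lt.le⟩
  refine ⟨(ContinuousLinearMap.mul ℝ ℝ).lpPairing μ (ENNReal.ofReal q) (ENNReal.ofReal p)
    (hkL.toLp k), fun f => ?_⟩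
  have hval : (ContinuousLinearMap.mul ℝ ℝ).lpPairing μ (ENNReal.ofReal q) (ENNReal.ofReal p)
      (hkL.toLp k) f = ∫ t, k t * f t ∂μ := by
    rw [ContinuousLinearMap.lpPairing_eq_integral]
    refine integral_congr_ae ?_
    filter_upwards [hkL.coeFn_toLp] with t ht
    simp [ht]
  refine ⟨?_, ?_, ?_⟩
  · have h : Integrable (fun t => k t * f t) μ := hkL.integrable_mul (Lp.memLp f)
    rw [hfk, integrable_indicator_iff measurableSet_Ioc, IntegrableOn, hrestr] at h
    rwa [intervalIntegrable_iff_integrableOn_Ioc_of_le hab]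
  · rw [hval, hfk, integral_indicator measurableSet_Ioc, hrestr,
      intervalIntegral.integral_of_le hab]
  · rw [hval]
    calc |∫ t, k t * f t ∂μ| ≤ ∫ t, ‖k t * f t‖ ∂μ := by
          rw [← Real.norm_eq_abs]
          exact norm_integral_le_integral_norm _
      _ = ∫ t, ‖f t‖ * ‖k t‖ ∂μ := by simp only [norm_mul, mul_comm]
      _ ≤ (∫ t, ‖f t‖ ^ p ∂μ) ^ (1 / p) * (∫ t, ‖k t‖ ^ q ∂μ) ^ (1 / q) :=
        integral_mul_norm_le_Lp_mul_Lq hpq (Lp.memLp f) hkL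
      _ = _ := by
        have := Lp_norm_rpow_eq_integral hp0 f
        simp only [Real.norm_eq_abs] at hkint ⊢
        rw [hkint, ← this, ← Real.rpow_mul (norm_nonneg _), mul_one_div_cancel hp0.ne',
          Real.rpow_one]

theorem wInt_weighted_Lp {α : ℝ} (hα : 0 ≤ α) (hp : 0 < p) (hαp : 1 / q * p = α)
    (f : Lp ℝ (ENNReal.ofReal p) (volume.restrict (Set.Ioi (0 : ℝ)))) :
    wInt α (fun t => |f t * t ^ (-(1 / q))| ^ p) = ENNReal.ofReal (omegaW α * ‖f‖ ^ p) := by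
  rw [wInt, ENNReal.ofReal_mul (omegaW_pos hα).le, Lp_norm_rpow_eq_integral hp,
    ofReal_integral_eq_lintegral_ofReal (Lp_integrable_abs_rpow hp f)
      (Eventually.of_forall fun t => by positivity)]
  congr 1
  refine setLIntegral_congr_fun measurableSet_Ioi fun t ht => ?_
  have ht0 : 0 < t := ht
  rw [← ENNReal.ofReal_mul (by positivity), abs_mul, abs_of_pos (Real.rpow_pos_of_pos ht0 _),
    Real.mul_rpow (abs_nonneg _) (by positivity), mul_assoc, ← Real.rpow_mul ht0.le,
    ← Real.rpow_add ht0, neg_mul, hαp, neg_add_cancel, Real.rpow_zero, mul_one]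

theorem wNorm_rpow (θ : ℝ) (hp : 0 < p) (u : ℝ → ℝ) :
    wNorm θ p u ^ p = wInt θ fun r => |u r| ^ p := by
  rw [wNorm, ← ENNReal.rpow_mul, one_div_mul_cancel hp.ne', ENNReal.rpow_one]

theorem Xnorm_le_one_iff {α θ : ℝ} (hp : 0 < p) (u u' : ℝ → ℝ) :
    Xnorm p α θ u u' ≤ 1 ↔
      (wInt θ fun r => |u r| ^ p) + (wInt α fun r => |u' r| ^ p) ≤ 1 := by
  rw [Xnorm, wNorm_rpow θ hp, wNorm_rpow α hp]
  conv_lhs => rw [← ENNReal.one_rpow (1 / p)]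
  exact ENNReal.rpow_le_rpow_iff (by positivity)

theorem MemX.exists_Lp {α θ : ℝ} {u u' : ℝ → ℝ} (hp : 0 < p) (hα : 0 ≤ α)
    (hαp : 1 / q * p = α) (h : MemX p α θ u u') (h1 : Xnorm p α θ u u' ≤ 1) :
    ∃ f : Lp ℝ (ENNReal.ofReal p) (volume.restrict (Set.Ioi (0 : ℝ))),
      (∀ a b : ℝ, 0 < a → a ≤ b → u b - u a = ∫ t in a..b, f t * t ^ (-(1 / q))) ∧
      (wInt θ fun r => |u r| ^ p) + ENNReal.ofReal (omegaW α * ‖f‖ ^ p) ≤ 1 := by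
  have hω := omegaW_pos hα
  rw [Xnorm_le_one_iff hp] at h1
  have hm : AEStronglyMeasurable u' (volume.restrict (Set.Ioi (0 : ℝ))) := by
    have hU : Set.Ioi (0 : ℝ) ⊆ ⋃ n : ℕ, Set.Ioc (1 / ((n : ℝ) + 1)) ((n : ℝ) + 1) := by
      intro t ht
      obtain ⟨n, hn⟩ := exists_nat_one_div_lt (Set.mem_Ioi.1 ht)
      obtain ⟨m, hm⟩ := exists_nat_ge t
      refine Set.mem_iUnion.2 ⟨max n m, lt_of_le_of_lt ?_ hn, ?_⟩
      · have : (n : ℝ) ≤ (max n m : ℕ) := by exact_mod_cast le_max_left _ _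
        gcongr
      · have : (m : ℝ) ≤ (max n m : ℕ) := by exact_mod_cast le_max_right _ _
        linarith
    refine AEStronglyMeasurable.mono_set hU (AEStronglyMeasurable.iUnion fun n => ?_)
    have hn : 1 / ((n : ℝ) + 1) ≤ (n : ℝ) + 1 := by
      have hn0 : (0 : ℝ) ≤ n := n.cast_nonneg
      rw [div_le_iff₀ (by positivity)]
      nlinarith
    have hi := h.ftc_int _ _ (by positivity) hn
    rw [intervalIntegrable_iff_integrableOn_Ioc_of_le hn] at hi
    exact hi.aestronglyMeasurable
  set g : ℝ → ℝ := fun t => u' t * t ^ (1 / q) with hg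
  have hgm : AEStronglyMeasurable g (volume.restrict (Set.Ioi (0 : ℝ))) := by
    refine hm.mul ?_
    exact (by fun_prop : Measurable fun t : ℝ => t ^ (1 / q)).aestronglyMeasurable
  have hgL : MemLp g (ENNReal.ofReal p) (volume.restrict (Set.Ioi (0 : ℝ))) := by
    refine ⟨hgm, ?_⟩
    rw [eLpNorm_lt_top_iff_lintegral_rpow_enorm_lt_top (by simpa using hp) ENNReal.ofReal_ne_top,
      ENNReal.toReal_ofReal hp.le]
    have hfin : wInt α (fun r => |u' r| ^ p) < ⊤ :=
      lt_of_le_of_lt (le_add_self.trans h1) ENNReal.one_lt_top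
    rw [wInt] at hfin
    have hfin2 := ENNReal.lt_top_of_mul_ne_top_right hfin.ne (by simpa using hω)
    refine lt_of_le_of_lt (le_of_eq ?_) hfin2
    refine setLIntegral_congr_fun measurableSet_Ioi fun t ht => ?_
    have ht0 : 0 < t := ht
    simp only [hg]
    rw [← ofReal_norm, ENNReal.ofReal_rpow_of_nonneg (norm_nonneg _) hp.le,
      ← ENNReal.ofReal_mul (by positivity), norm_mul, Real.norm_of_nonneg (Real.rpow_nonneg ht0.le _),
      Real.mul_rpow (norm_nonneg _) (by positivity), ← Real.rpow_mul ht0.le, hαp, Real.norm_eq_abs]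
  have hae : ∀ᵐ t ∂(volume.restrict (Set.Ioi (0 : ℝ))), hgL.toLp g t * t ^ (-(1 / q)) = u' t := by
    filter_upwards [hgL.coeFn_toLp, ae_restrict_mem measurableSet_Ioi] with t ht ht0
    rw [ht, hg]
    simp only
    rw [mul_assoc, ← Real.rpow_add ht0, add_neg_cancel, Real.rpow_zero, mul_one]
  refine ⟨hgL.toLp g, fun a b ha hab => ?_, ?_⟩
  · rw [h.ftc a b ha hab, intervalIntegral.integral_of_le hab, intervalIntegral.integral_of_le hab]
    refine integral_congr_ae ?_
    filter_upwards [ae_restrict_of_ae_restrict_of_subset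
      (show Set.Ioc a b ⊆ Set.Ioi 0 from fun t ht => ha.trans ht.1) hae] with t ht
    exact ht.symm
  · rw [← wInt_weighted_Lp hα hp hαp]
    refine le_trans (le_of_eq ?_) h1
    congr 1
    unfold wInt
    congr 1
    refine lintegral_congr_ae ?_
    filter_upwards [hae] with t ht
    rw [ht]
end

/-- A pointwise bounded log-Hölder sequence has a pointwise convergent subsequence. -/
theorem LogHolder.exists_subseq_tendsto {D q R : ℝ} (hq : 0 < q) (hR : 0 < R) {u : ℕ → ℝ → ℝ}
    (hu : ∀ n, LogHolder D q (u n)) (hb : ∀ n, |u n R| ≤ 1) :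
    ∃ φ : ℕ → ℕ, StrictMono φ ∧ ∃ v : ℝ → ℝ,
      ∀ r, 0 < r → Tendsto (fun n => u (φ n) r) atTop (nhds (v r)) := by
  set M : ℝ → ℝ := fun r => 1 + D * |Real.log r - Real.log R| ^ (1 / q) with hM
  have hbd : ∀ n r, 0 < r → |u n r| ≤ M r := by
    intro n r hr
    have h1 := hu n R r hR hr
    have h2 := abs_sub_abs_le_abs_sub (u n r) (u n R)
    linarith [hb n]
  set x : ℕ → ℚ → ℝ := fun n s => if 0 < s then u n s else 0 with hx
  set S : Set (ℚ → ℝ) := Set.pi Set.univ fun s => Metric.closedBall 0 |M s| with hS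
  have hSc : IsCompact S := isCompact_univ_pi fun s => isCompact_closedBall _ _
  have hxS : ∀ n, x n ∈ S := by
    intro n s _
    rw [mem_closedBall_zero_iff, Real.norm_eq_abs]
    by_cases hs : 0 < s
    · simp only [hx, if_pos hs]
      exact (hbd n s (by exact_mod_cast hs)).trans (le_abs_self _)
    · simp [hx, if_neg hs]
  obtain ⟨y, -, φ, hφ, hlim⟩ := hSc.tendsto_subseq hxS
  rw [tendsto_pi_nhds] at hlim
  refine ⟨φ, hφ, ?_⟩
  have hcau : ∀ r, 0 < r → ∃ v, Tendsto (fun n => u (φ n) r) atTop (nhds v) := by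
    intro r hr
    refine cauchySeq_tendsto_of_complete (Metric.cauchySeq_iff'.2 fun ε hε => ?_)
    have hev := (tendsto_mul_abs_log_sub_rpow D hq hr).eventually_lt_const
      (show (0 : ℝ) < ε / 3 by positivity)
    obtain ⟨δ, hδ, hball⟩ := Metric.eventually_nhds_iff.1 hev
    obtain ⟨s, hs1, hs2⟩ := exists_rat_btwn (show r < r + δ by linarith)
    have hs0 : (0 : ℝ) < s := hr.trans hs1
    have hs0' : 0 < s := by exact_mod_cast hs0
    have hsmall := hball (y := (s : ℝ)) (by rw [Real.dist_eq, abs_of_pos] <;> linarith)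
    have hcs : CauchySeq fun n => u (φ n) s := by
      have := hlim s
      simp only [Function.comp_apply, hx, if_pos hs0'] at this
      exact this.cauchySeq
    obtain ⟨N, hN⟩ := Metric.cauchySeq_iff'.1 hcs (ε / 3) (by positivity)
    refine ⟨N, fun n hn => ?_⟩
    have h1 := hN n hn
    have h2 := hu (φ n) r s hr hs0
    have h3 := hu (φ N) r s hr hs0
    rw [Real.dist_eq] at h1 ⊢
    rw [abs_lt] at h1 ⊢
    rw [abs_le] at h2 h3
    constructor <;> linarith [h2.1, h2.2, h3.1, h3.2, h1.1, h1.2]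
  choose! v hv using hcau
  exact ⟨v, hv⟩

theorem LogHolder.of_tendsto {D q : ℝ} {u : ℕ → ℝ → ℝ} {v : ℝ → ℝ}
    (hu : ∀ n, LogHolder D q (u n))
    (hlim : ∀ r, 0 < r → Tendsto (fun n => u n r) atTop (nhds (v r))) : LogHolder D q v :=
  fun r s hr hs => le_of_tendsto' ((hlim s hs).sub (hlim r hr)).abs fun n => hu n r s hr hs

theorem wInt_add_le_one_of_tendsto {p θ D q : ℝ} (hp : 0 < p) (hq : 0 < q) {u : ℕ → ℝ → ℝ}
    {v : ℝ → ℝ} {c : ℕ → ℝ≥0∞} {d : ℝ≥0∞} (hu : ∀ n, LogHolder D q (u n))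
    (hlim : ∀ r, 0 < r → Tendsto (fun n => u n r) atTop (nhds (v r)))
    (hc : Tendsto c atTop (nhds d))
    (h : ∀ n, (wInt θ fun r => |u n r| ^ p) + c n ≤ 1) :
    (wInt θ fun r => |v r| ^ p) + d ≤ 1 := by
  have hd1 : d ≤ 1 := le_of_tendsto' hc fun n => le_add_self.trans (h n)
  have hsub : Tendsto (fun n => 1 - c n) atTop (nhds (1 - d)) :=
    ENNReal.Tendsto.sub tendsto_const_nhds hc (Or.inl ENNReal.one_ne_top)
  have hfatou : (wInt θ fun r => |v r| ^ p) ≤ 1 - d := by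
    calc (wInt θ fun r => |v r| ^ p)
        = ENNReal.ofReal (omegaW θ) * ∫⁻ r in Set.Ioi 0, liminf (fun n =>
            ENNReal.ofReal (|u n r| ^ p) * ENNReal.ofReal (r ^ θ)) atTop := by
          unfold wInt
          congr 1
          refine setLIntegral_congr_fun measurableSet_Ioi fun r hr => ?_
          refine (Tendsto.liminf_eq ?_).symm
          refine ENNReal.Tendsto.mul_const ?_ (Or.inr ENNReal.ofReal_ne_top)
          exact ENNReal.tendsto_ofReal ((hlim r hr).abs.rpow_const (Or.inr hp.le))
      _ ≤ ENNReal.ofReal (omegaW θ) * liminf (fun n => ∫⁻ r in Set.Ioi 0,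
            ENNReal.ofReal (|u n r| ^ p) * ENNReal.ofReal (r ^ θ)) atTop := by
          gcongr
          refine lintegral_liminf_le' fun n => ?_
          have hm : AEMeasurable (u n) (volume.restrict (Set.Ioi 0)) :=
            ((hu n).continuousOn hq).aemeasurable measurableSet_Ioi
          exact ((measurable_norm.comp_aemeasurable hm).pow_const p).ennreal_ofReal.mul
            (by fun_prop)
      _ = liminf (fun n => wInt θ fun r => |u n r| ^ p) atTop := by
          unfold wInt
          exact (ENNReal.liminf_const_mul_of_ne_top ENNReal.ofReal_ne_top).symm
      _ ≤ liminf (fun n => 1 - c n) atTop := by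
          refine liminf_le_liminf (Eventually.of_forall fun n => ?_)
          exact ENNReal.le_sub_of_add_le_right
            (ne_top_of_le_ne_top ENNReal.one_ne_top (le_add_self.trans (h n))) (h n)
      _ = 1 - d := hsub.liminf_eq
  calc (wInt θ fun r => |v r| ^ p) + d ≤ (1 - d) + d := by gcongr
    _ = 1 := tsub_add_cancel_of_le hd1

theorem exists_maximizing_sequence (p α θ σ : ℝ) (hp : 0 < p) :
    ∃ u u' : ℕ → ℝ → ℝ, (∀ n, MemX p α θ (u n) (u' n)) ∧ (∀ n, Xnorm p α θ (u n) (u' n) ≤ 1) ∧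
      Tendsto (fun n => TMfunc p θ σ (u n)) atTop (nhds (TMC p α θ σ)) := by
  set S : Set ℝ≥0∞ :=
    {x | ∃ u u' : ℝ → ℝ, MemX p α θ u u' ∧ Xnorm p α θ u u' ≤ 1 ∧ TMfunc p θ σ u = x} with hS
  have hzero : ∀ η, (wInt η fun _ => |(0 : ℝ)| ^ p) = 0 := fun η => by
    simp [wInt, Real.zero_rpow hp.ne']
  have hne : S.Nonempty := by
    refine ⟨_, fun _ => 0, fun _ => 0, ⟨?_, ?_, ?_, ?_, ?_⟩, ?_, rfl⟩
    · simp
    · simp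
    · simp
    · rw [wNorm, hzero, ENNReal.zero_rpow_of_pos (by positivity)]; simp
    · rw [wNorm, hzero, ENNReal.zero_rpow_of_pos (by positivity)]; simp
    · rw [Xnorm_le_one_iff hp, hzero, hzero]; simp
  have hsup : TMC p α θ σ = sSup S := by
    refine le_antisymm ?_ (sSup_le ?_)
    · exact iSup_le fun u => iSup_le fun u' => iSup_le fun h => iSup_le fun h1 =>
        le_sSup ⟨u, u', h, h1, rfl⟩
    · rintro _ ⟨u, u', h, h1, rfl⟩
      exact le_iSup_of_le u (le_iSup_of_le u' (le_iSup_of_le h (le_iSup_of_le h1 le_rfl)))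
  obtain ⟨x, -, hx, hxS⟩ := exists_seq_tendsto_sSup hne (OrderTop.bddAbove S)
  choose u u' h h1 h2 using hxS
  refine ⟨u, u', h, h1, ?_⟩
  simp only [h2]
  rwa [hsup]

theorem stmt_7 (p α θ : ℝ) (hp : 2 ≤ p) (hα : α = p - 1) (hθ : 0 ≤ θ)
    (hk : p - 1 < (k0 p : ℝ)) :
    ∀ σ : ℝ, 0 < σ → σ < muC α θ → TMCAttained p α θ σ := by
  intro σ hσ hσμ
  have hp0 : 0 < p := by linarith
  have hp1 : 0 < p - 1 := by linarith
  have hα0 : 0 < α := by linarith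
  set q := p / (p - 1) with hq
  have hq0 : 0 < q := by positivity
  have hpq : p.HolderConjugate q := by
    rw [Real.holderConjugate_iff]
    refine ⟨by linarith, ?_⟩
    rw [hq]
    field_simp
    ring
  have hαp : 1 / q * p = α := by
    rw [hq, hα]
    field_simp
  have hqα : q / p = 1 / α := by
    rw [hq, hα]
    field_simp
  have hpk : p < q * k0 p := by
    rw [hq, div_mul_eq_mul_div, lt_div_iff₀ hp1]
    gcongr
  have hω := omegaW_pos hα0.le
  set D := omegaW α ^ (-(1 / p)) with hDdef
  have hD : 0 < D := by positivity
  have hDω : ∀ x : ℝ, 0 ≤ x → omegaW α * x ^ p ≤ 1 → x ≤ D := by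
    intro x hx h
    rw [hDdef, Real.rpow_neg hω.le, ← Real.inv_rpow hω.le,
      ← Real.rpow_le_rpow_iff hx (by positivity) hp0, ← Real.rpow_mul (by positivity),
      one_div_mul_cancel hp0.ne', Real.rpow_one, ← one_div, le_div_iff₀' hω]
    exact h
  have hcrit : σ * D ^ q < θ + 1 := by
    rw [hDdef, ← Real.rpow_mul hω.le, show -(1 / p) * q = -(q / p) by ring, hqα,
      Real.rpow_neg hω.le, ← div_eq_mul_inv, div_lt_iff₀ (by positivity)]
    exact hσμ
  have hfact : Fact (1 ≤ ENNReal.ofReal p) := ⟨by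
    rw [ENNReal.one_le_ofReal]; linarith⟩
  obtain ⟨u, u', hu, hu1, hT⟩ := exists_maximizing_sequence p α θ σ hp0
  choose f hf hf1 using fun n => (hu n).exists_Lp hp0 hα0.le hαp (hu1 n)
  have hA : ∀ n, (wInt θ fun r => |u n r| ^ p) ≤ 1 := fun n => le_self_add.trans (hf1 n)
  have hfD : ∀ n, ‖f n‖ ≤ D := fun n => by
    refine hDω _ (norm_nonneg _) ?_
    rw [← ENNReal.ofReal_le_one]
    exact le_add_self.trans (hf1 n)
  have hlh : ∀ n, LogHolder D q (u n) := by
    intro n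
    have key : ∀ r s, 0 < r → r ≤ s → |u n s - u n r| ≤ D * |Real.log s - Real.log r| ^ (1 / q) := by
      intro r s hr hrs
      obtain ⟨ℓ, hℓ⟩ := exists_weighted_interval_functional hpq hr hrs
      obtain ⟨-, h2, h3⟩ := hℓ (f n)
      rw [hf n r s hr hrs, ← h2, abs_of_nonneg (sub_nonneg.2 (Real.log_le_log hr hrs))]
      refine h3.trans ?_
      have : 0 ≤ Real.log s - Real.log r := sub_nonneg.2 (Real.log_le_log hr hrs)
      gcongr
      exact hfD n
    intro r s hr hs
    rcases le_total r s with h | h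
    · exact key r s hr h
    · rw [abs_sub_comm (u n s), abs_sub_comm (Real.log s)]
      exact key s r hs h
  obtain ⟨R, hR1, hR⟩ := LogHolder.exists_uniform_decay hp0 hθ hq0 hD one_pos
  obtain ⟨φ, hφ, v, hv⟩ := LogHolder.exists_subseq_tendsto hq0 (by linarith : 0 < R) hlh
    fun n => hR (u n) (hlh n) (hA n) R le_rfl
  obtain ⟨b, -, ψ, hψ, hb⟩ := (isCompact_Icc (a := (0 : ℝ)) (b := D)).tendsto_subseq
    (x := fun n => ‖f (φ n)‖) fun n => ⟨norm_nonneg _, hfD _⟩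
  set χ : ℕ → ℕ := φ ∘ ψ with hχ
  have hvχ : ∀ r, 0 < r → Tendsto (fun n => u (χ n) r) atTop (nhds (v r)) := fun r hr =>
    (hv r hr).comp hψ.tendsto_atTop
  obtain ⟨G, hGb, hG⟩ := Lp_exists_weak_limit hp (fun n => f (χ n)) hb
  have hvlh : LogHolder D q v := LogHolder.of_tendsto (fun n => hlh (χ n)) hvχ
  have hvftc : ∀ a b : ℝ, 0 < a → a ≤ b →
      IntervalIntegrable (fun t => G t * t ^ (-(1 / q))) volume a b ∧
      v b - v a = ∫ t in a..b, G t * t ^ (-(1 / q)) := by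
    intro a b ha hab
    obtain ⟨ℓ, hℓ⟩ := exists_weighted_interval_functional hpq ha hab
    refine ⟨(hℓ G).1, ?_⟩
    rw [← (hℓ G).2.1]
    refine (hG ℓ _ ?_).symm
    refine ((hvχ b (ha.trans_le hab)).sub (hvχ a ha)).congr fun n => ?_
    rw [hf (χ n) a b ha hab, (hℓ _).2.1]
  have henergy : (wInt θ fun r => |v r| ^ p) + (wInt α fun t => |G t * t ^ (-(1 / q))| ^ p) ≤ 1 := by
    rw [wInt_weighted_Lp hα0.le hp0 hαp]
    have hc : Tendsto (fun n => ENNReal.ofReal (omegaW α * ‖f (χ n)‖ ^ p)) atTop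
        (nhds (ENNReal.ofReal (omegaW α * b ^ p))) :=
      ENNReal.tendsto_ofReal ((hb.rpow_const (Or.inr hp0.le)).const_mul _)
    refine le_trans ?_ (wInt_add_le_one_of_tendsto hp0 hq0 (fun n => hlh (χ n)) hvχ hc
      fun n => hf1 (χ n))
    gcongr
  have hvA : (wInt θ fun r => |v r| ^ p) ≤ 1 := le_self_add.trans henergy
  have hvB : (wInt α fun t => |G t * t ^ (-(1 / q))| ^ p) ≤ 1 := le_add_self.trans henergy
  have hmem : MemX p α θ v fun t => G t * t ^ (-(1 / q)) := by
    refine ⟨fun a b ha hab => (hvftc a b ha hab).1, fun a b ha hab => (hvftc a b ha hab).2,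
      ?_, ?_, ?_⟩
    · refine Metric.tendsto_atTop.2 fun ε hε => ?_
      obtain ⟨R', -, hR'⟩ := LogHolder.exists_uniform_decay hp0 hθ hq0 hD (half_pos hε)
      refine ⟨R', fun r hr => ?_⟩
      rw [Real.dist_eq, sub_zero]
      linarith [hR' v hvlh hvA r hr]
    · exact ENNReal.rpow_lt_top_of_nonneg (by positivity) (ne_top_of_le_ne_top ENNReal.one_ne_top hvA)
    · exact ENNReal.rpow_lt_top_of_nonneg (by positivity) (ne_top_of_le_ne_top ENNReal.one_ne_top hvB)
  have hX : Xnorm p α θ v (fun t => G t * t ^ (-(1 / q))) ≤ 1 := (Xnorm_le_one_iff hp0 _ _).2 henergy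
  refine ⟨v, _, hmem, hX, le_antisymm ?_ ?_⟩
  · exact le_TMfunc_of_tendsto hp0 hθ hq hq0 hpk hD hσ hcrit (fun n => hlh (χ n))
      (fun n => hA (χ n)) hvχ (hT.comp (hφ.comp hψ).tendsto_atTop)
  · exact le_iSup_of_le v (le_iSup_of_le _ (le_iSup_of_le hmem (le_iSup_of_le hX le_rfl)))
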